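/- Define the polynomial g(x,y) = 83808*y + 52812*x^2 + 16900*y^2 - 37248*y^3 - 4896*x^2*y^2 - 34416*x^4 - 17280*x^4*y - 13824*x^2*y^3 + 9216*y^4 + 5184*x^4*y^2 + 5184*x^6 - 84681 + 6240*x^2*y. Then the set of real points (x,y) with g(x,y) = 0, ∂g/∂x(x,y) = 0 and ∂g/∂y(x,y) = 0 is exactly the three-element set {S1, S2, S3}, where S1 = (0, 97/48), S2 = (sqrt(65 + 36*12^(1/3) - 27*12^(2/3))/6, 3*12^(1/3)/4 - 1/3), and S3 = (-sqrt(65 + 36*12^(1/3) - 27*12^(2/3))/6, 3*12^(1/3)/4 - 1/3). (In particular, 65 + 36*12^(1/3) - 27*12^(2/3) ≥ 0, where 12^(1/3) denotes the real cube root of 12.) -/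

import Mathlib

/-- The polynomial defining the parallel lines at offset r = 3/2 to the parabola
4*(1/3)*y = x^2. -/
noncomputable def g14 (x y : ℝ) : ℝ :=
  83808*y + 52812*x^2 + 16900*y^2 - 37248*y^3 - 4896*x^2*y^2 - 34416*x^4 - 17280*x^4*y -
    13824*x^2*y^3 + 9216*y^4 + 5184*x^4*y^2 + 5184*x^6 - 84681 + 6240*x^2*y

set_option maxHeartbeats 4000000 in
lemma keyI (u y : ℝ)
 (h0 : 5184*u^3 + u^2*(5184*y^2 -17280*y -34416) + u*(-13824*y^3 -4896*y^2+6240*y+52812) + (9216*y^4 -37248*y^3+16900*y^2+83808*y-84681) = 0)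
 (h1 : 15552*u^2 + 2*u*(5184*y^2 -17280*y -34416) + (-13824*y^3 -4896*y^2+6240*y+52812) = 0)
 (h2 : u^2*(10368*y -17280) + u*(-41472*y^2 -9792*y+6240) + (36864*y^3 -111744*y^2+33800*y+83808) = 0) :
  27/4*u+9*y^2-3*y+1-243/16 = 0 := by
  grind

set_option maxHeartbeats 4000000 in
lemma keyZ (u y : ℝ)
 (hI : 27/4*u+9*y^2-3*y+1-243/16 = 0)
 (h0 : 5184*u^3 + u^2*(5184*y^2 -17280*y -34416) + u*(-13824*y^3 -4896*y^2+6240*y+52812) + (9216*y^4 -37248*y^3+16900*y^2+83808*y-84681) = 0) :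
  (4*(y+1/3)/3)^3 = 12 := by
  have : ((4*(y+1/3)/3)^3 - 12)^2 = 0 := by
    grind
  have := pow_eq_zero_iff (two_ne_zero) |>.1 this
  linarith

lemma dx14 (x y : ℝ) : deriv (fun t : ℝ => g14 t y) x =
    2*x*(15552*(x^2)^2 + 2*x^2*(5184*y^2 -17280*y -34416) + (-13824*y^3 -4896*y^2+6240*y+52812)) := by
  have h : (fun t : ℝ => g14 t y) = fun t => (Polynomial.C 5184 * Polynomial.X^6 + Polynomial.C (5184*y^2 -17280*y -34416) * Polynomial.X^4 + Polynomial.C (-13824*y^3 -4896*y^2+6240*y+52812) * Polynomial.X^2 + Polynomial.C (9216*y^4 -37248*y^3+16900*y^2+83808*y-84681) : Polynomial ℝ).eval t := by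
    funext t
    simp only [g14, Polynomial.eval_add, Polynomial.eval_mul, Polynomial.eval_C, Polynomial.eval_pow, Polynomial.eval_X]
    ring
  rw [h, Polynomial.deriv]
  simp only [Polynomial.derivative_add, Polynomial.derivative_C_mul_X_pow, Polynomial.derivative_C,
    Polynomial.eval_add, Polynomial.eval_mul, Polynomial.eval_C, Polynomial.eval_pow, Polynomial.eval_X, Polynomial.eval_zero]
  push_cast
  ring

lemma dy14 (x y : ℝ) : deriv (fun t : ℝ => g14 x t) y =
    (x^2)^2*(10368*y -17280) + x^2*(-41472*y^2 -9792*y+6240) + (36864*y^3 -111744*y^2+33800*y+83808) := by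
  have h : (fun t : ℝ => g14 x t) = fun t => (Polynomial.C 9216 * Polynomial.X^4 + Polynomial.C (-13824*x^2-37248) * Polynomial.X^3 + Polynomial.C (5184*x^4-4896*x^2+16900) * Polynomial.X^2 + Polynomial.C (83808-17280*x^4+6240*x^2) * Polynomial.X^1 + Polynomial.C (5184*x^6-34416*x^4+52812*x^2-84681) : Polynomial ℝ).eval t := by
    funext t
    simp only [g14, Polynomial.eval_add, Polynomial.eval_mul, Polynomial.eval_C, Polynomial.eval_pow, Polynomial.eval_X]
    ring
  rw [h, Polynomial.deriv]
  simp only [Polynomial.derivative_add, Polynomial.derivative_C_mul_X_pow, Polynomial.derivative_C,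
    Polynomial.eval_add, Polynomial.eval_mul, Polynomial.eval_C, Polynomial.eval_pow, Polynomial.eval_X, Polynomial.eval_zero]
  push_cast
  ring

theorem parabola_supercritical_three_singular_points :
    0 ≤ 65 + 36*(12:ℝ)^((1:ℝ)/3) - 27*(12:ℝ)^((2:ℝ)/3) ∧
    {q : ℝ × ℝ | g14 q.1 q.2 = 0 ∧
        deriv (fun t : ℝ => g14 t q.2) q.1 = 0 ∧
        deriv (fun t : ℝ => g14 q.1 t) q.2 = 0}
      = {((0 : ℝ), (97/48 : ℝ)),
         (Real.sqrt (65 + 36*(12:ℝ)^((1:ℝ)/3) - 27*(12:ℝ)^((2:ℝ)/3))/6,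
          3*(12:ℝ)^((1:ℝ)/3)/4 - 1/3),
         (-(Real.sqrt (65 + 36*(12:ℝ)^((1:ℝ)/3) - 27*(12:ℝ)^((2:ℝ)/3))/6),
          3*(12:ℝ)^((1:ℝ)/3)/4 - 1/3)} := by
  have hc3 : ((12:ℝ)^((1:ℝ)/3))^3 = 12 := by
    rw [← Real.rpow_natCast, ← Real.rpow_mul (by norm_num)]; norm_num
  have hc2 : (12:ℝ)^((2:ℝ)/3) = ((12:ℝ)^((1:ℝ)/3))^2 := by
    rw [← Real.rpow_natCast, ← Real.rpow_mul (by norm_num)]; norm_num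
  have hc0 : 0 < (12:ℝ)^((1:ℝ)/3) := by positivity
  rw [hc2]
  generalize (12:ℝ)^((1:ℝ)/3) = c at hc3 hc0
  have hlt : c < 23/10 := lt_of_pow_lt_pow_left₀ 3 (by norm_num) (by rw [hc3]; norm_num)
  have hN : 0 ≤ 65 + 36*c - 27*c^2 := by nlinarith
  refine ⟨hN, ?_⟩
  have hs := Real.sq_sqrt hN
  generalize Real.sqrt (65 + 36*c - 27*c^2) = s at hs
  have hcusp : ∀ x : ℝ, x^2 = (65 + 36*c - 27*c^2)/36 → g14 x (3*c/4-1/3) = 0 ∧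
      deriv (fun t : ℝ => g14 t (3*c/4-1/3)) x = 0 ∧
      deriv (fun t : ℝ => g14 x t) (3*c/4-1/3) = 0 := by
    intro x hx
    rw [dx14, dy14]
    have hg : g14 x (3*c/4-1/3) = 5184*(x^2)^3 + (x^2)^2*(5184*(3*c/4-1/3)^2 -17280*(3*c/4-1/3) -34416) + (x^2)*(-13824*(3*c/4-1/3)^3 -4896*(3*c/4-1/3)^2+6240*(3*c/4-1/3)+52812) + (9216*(3*c/4-1/3)^4 -37248*(3*c/4-1/3)^3+16900*(3*c/4-1/3)^2+83808*(3*c/4-1/3)-84681) := by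
      unfold g14; ring
    rw [hg, hx]
    refine ⟨by grind, ?_, by grind⟩
    apply mul_eq_zero_of_right
    grind
  ext ⟨x, y⟩
  simp only [Set.mem_setOf_eq, Set.mem_insert_iff, Set.mem_singleton_iff, Prod.mk.injEq]
  constructor
  · rintro ⟨h0, h1, h2⟩
    rw [dx14] at h1
    rw [dy14] at h2
    rcases mul_eq_zero.1 h1 with hx | h1
    · left
      have hx : x = 0 := by linarith
      subst hx
      refine ⟨rfl, ?_⟩
      unfold g14 at h0
      grind
    · right
      have h0' : 5184*(x^2)^3 + (x^2)^2*(5184*y^2 -17280*y -34416) + (x^2)*(-13824*y^3 -4896*y^2+6240*y+52812) + (9216*y^4 -37248*y^3+16900*y^2+83808*y-84681) = 0 := by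
        rw [← h0]; unfold g14; ring
      have hI := keyI (x^2) y h0' h1 h2
      have hZ := keyZ (x^2) y hI h0'
      have hz : 4*(y+1/3)/3 = c := by
        have ho : Odd 3 := by decide
        exact ho.strictMono_pow.injective (hZ.trans hc3.symm)
      have hy : y = 3*c/4 - 1/3 := by linarith
      have hx : x^2 = (s/6)^2 := by
        rw [div_pow, hs]; subst hy; linarith
      rcases sq_eq_sq_iff_eq_or_eq_neg.1 hx with h | h
      · exact Or.inl ⟨h, hy⟩
      · exact Or.inr ⟨h, hy⟩
  · rintro (⟨rfl, rfl⟩ | ⟨rfl, rfl⟩ | ⟨rfl, rfl⟩)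
    · rw [dx14, dy14]; unfold g14; norm_num
    · exact hcusp _ (by rw [div_pow, hs]; norm_num)
    · exact hcusp _ (by rw [neg_sq, div_pow, hs]; norm_num)
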